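/- arXiv:1109.0635 — 2 statements merged into one kernel-verified Lean document; each statement's English description precedes it below -/
import Mathlib

section
/- Let d ≥ 2 and p_1,…,p_d, r ∈ (1,∞) satisfy Σ_{i=1}^d 1/p_i = 1/r. Let T_1,…,T_d be measure preserving transformations of (X,𝓕,μ). Then the operators (1/(n_1⋯n_d)) Σ_{0 ≤ k_1 < n_1,…,0 ≤ k_d < n_d} V^{(k_1,…,k_d)} converge, as n_1,…,n_d → ∞, in the strong operator topology on the projective tensor product L_{p_1}(μ) ⊗̂_π ⋯ ⊗̂_π L_{p_d}(μ), to the operator E_{inv,1} ⊗_π ⋯ ⊗_π E_{inv,d}. -/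
open MeasureTheory Filter Topology ENNReal ProbabilityTheory

noncomputable section

namespace VonMises

variable {X : Type} [MeasurableSpace X]

/-- The `d`-fold product measure `μ^d` on the power space `X^d`. -/
abbrev pm (μ : Measure X) (d : ℕ) : Measure (Fin d → X) := Measure.pi fun _ => μ

/-- `(E, tp)` is (a realization of) the projective tensor product
`L_{p 0}(μ) ⊗̂_π ⋯ ⊗̂_π L_{p (d-1)}(μ)`: `tp` is a continuous multilinear map
satisfying the cross-norm identity, whose range spans a dense subspace, and which has
the (isometric) universal lifting property of the projective tensor norm. -/
structure IsPTP (μ : Measure X) {d : ℕ} (p : Fin d → ℝ≥0∞) [∀ i, Fact (1 ≤ p i)]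
    (E : Type) [NormedAddCommGroup E] [NormedSpace ℝ E] [CompleteSpace E]
    (tp : ContinuousMultilinearMap ℝ (fun i : Fin d => Lp ℝ (p i) μ) E) : Prop where
  crossNorm : ∀ f : ∀ i : Fin d, Lp ℝ (p i) μ, ‖tp f‖ = ∏ i, ‖f i‖
  denseSpan : Dense (Submodule.span ℝ (Set.range fun f : ∀ i : Fin d, Lp ℝ (p i) μ => tp f) : Set E)
  lift : ∀ (F : Type) [NormedAddCommGroup F] [NormedSpace ℝ F] [CompleteSpace F]
      (g : ContinuousMultilinearMap ℝ (fun i : Fin d => Lp ℝ (p i) μ) F),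
      ∃ L : E →L[ℝ] F, (∀ f, L (tp f) = g f) ∧ ‖L‖ = ‖g‖

/-- `J` realizes the canonical map from the projective tensor product into `L_q(μ^d)`,
determined by its values on elementary tensors. -/
def IsEmbed (μ : Measure X) {d : ℕ} (p : Fin d → ℝ≥0∞) [∀ i, Fact (1 ≤ p i)]
    (q : ℝ≥0∞) [Fact (1 ≤ q)]
    {E : Type} [NormedAddCommGroup E] [NormedSpace ℝ E] [CompleteSpace E]
    (tp : ContinuousMultilinearMap ℝ (fun i : Fin d => Lp ℝ (p i) μ) E)
    (J : E →L[ℝ] Lp ℝ q (pm μ d)) : Prop :=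
  ∀ f, (J (tp f) : (Fin d → X) → ℝ) =ᵐ[pm μ d] fun x => ∏ i, (f i : X → ℝ) (x i)

/-- `D` realizes the diagonal restriction operator: the norm-one linear map sending an
elementary tensor `f_1 ⊗ ⋯ ⊗ f_d` to the pointwise product `x ↦ f_1(x)⋯f_d(x)`. -/
def IsDiag (μ : Measure X) {d : ℕ} (p : Fin d → ℝ≥0∞) [∀ i, Fact (1 ≤ p i)]
    (r : ℝ≥0∞) [Fact (1 ≤ r)]
    {E : Type} [NormedAddCommGroup E] [NormedSpace ℝ E] [CompleteSpace E]
    (tp : ContinuousMultilinearMap ℝ (fun i : Fin d => Lp ℝ (p i) μ) E)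
    (D : E →L[ℝ] Lp ℝ r μ) : Prop :=
  ‖D‖ = 1 ∧ ∀ f, (D (tp f) : X → ℝ) =ᵐ[μ] fun x => ∏ i, (f i : X → ℝ) x

/-- `W` realizes the tensor Koopman operator `V^𝐤 = V_1^{k_1} ⊗_π ⋯ ⊗_π V_d^{k_d}`,
where `V_i g = g ∘ T_i`. -/
def IsTKoop (μ : Measure X) {d : ℕ} (p : Fin d → ℝ≥0∞) [∀ i, Fact (1 ≤ p i)]
    {E : Type} [NormedAddCommGroup E] [NormedSpace ℝ E] [CompleteSpace E]
    (tp : ContinuousMultilinearMap ℝ (fun i : Fin d => Lp ℝ (p i) μ) E)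
    (T : Fin d → X → X) (k : Fin d → ℕ) (W : E →L[ℝ] E) : Prop :=
  ∀ f g : ∀ i : Fin d, Lp ℝ (p i) μ,
    (∀ i, (g i : X → ℝ) =ᵐ[μ] fun x => (f i : X → ℝ) ((T i)^[k i] x)) → W (tp f) = tp g

/-- `g = V^{*k} f`: the adjoint (transfer) operator applied to `f`, characterized by
`∫_s g dμ = ∫_{T^{-k} s} f dμ` for all measurable `s`. -/
def IsTransfer (μ : Measure X) (T : X → X) (k : ℕ) {p : ℝ≥0∞} [Fact (1 ≤ p)]
    (f g : Lp ℝ p μ) : Prop :=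
  ∀ s : Set X, MeasurableSet s → ∫ x in s, g x ∂μ = ∫ x in T^[k] ⁻¹' s, f x ∂μ

/-- `W` realizes the tensor transfer operator `V^{*𝐤} = V_1^{*k_1} ⊗_π ⋯ ⊗_π V_d^{*k_d}`. -/
def IsTTrans (μ : Measure X) {d : ℕ} (p : Fin d → ℝ≥0∞) [∀ i, Fact (1 ≤ p i)]
    {E : Type} [NormedAddCommGroup E] [NormedSpace ℝ E] [CompleteSpace E]
    (tp : ContinuousMultilinearMap ℝ (fun i : Fin d => Lp ℝ (p i) μ) E)
    (T : Fin d → X → X) (k : Fin d → ℕ) (W : E →L[ℝ] E) : Prop :=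
  ∀ f g : ∀ i : Fin d, Lp ℝ (p i) μ,
    (∀ i, IsTransfer μ (T i) (k i) (f i) (g i)) → W (tp f) = tp g

/-- The σ-algebra of `T`-invariant measurable sets. -/
def invariants (T : X → X) : MeasurableSpace X where
  MeasurableSet' s := MeasurableSet s ∧ T ⁻¹' s = s
  measurableSet_empty := ⟨MeasurableSet.empty, rfl⟩
  measurableSet_compl s hs := ⟨hs.1.compl, by rw [Set.preimage_compl, hs.2]⟩
  measurableSet_iUnion s hs :=
    ⟨MeasurableSet.iUnion fun i => (hs i).1, by
      simp only [Set.preimage_iUnion]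
      exact Set.iUnion_congr fun i => (hs i).2⟩

/-- `W` realizes `E_{inv,1} ⊗_π ⋯ ⊗_π E_{inv,d}`, the projective tensor product of the
conditional expectations with respect to the invariant σ-fields. -/
def IsTCondexpInv (μ : Measure X) {d : ℕ} (p : Fin d → ℝ≥0∞) [∀ i, Fact (1 ≤ p i)]
    {E : Type} [NormedAddCommGroup E] [NormedSpace ℝ E] [CompleteSpace E]
    (tp : ContinuousMultilinearMap ℝ (fun i : Fin d => Lp ℝ (p i) μ) E)
    (T : Fin d → X → X) (W : E →L[ℝ] E) : Prop :=
  ∀ f g : ∀ i : Fin d, Lp ℝ (p i) μ,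
    (∀ i, (g i : X → ℝ) =ᵐ[μ] μ[(f i : X → ℝ) | invariants (T i)]) → W (tp f) = tp g

/-- Exactness of a measure preserving transformation: the tail σ-field
`⋂_n T^{-n}𝓕` is trivial mod `μ`. -/
def Exact (μ : Measure X) (T : X → X) : Prop :=
  ∀ s : Set X, (∀ n : ℕ, ∃ t : Set X, MeasurableSet t ∧ s = T^[n] ⁻¹' t) →
    μ s = 0 ∨ μ s = 1

/-- A kernel of `m` variables is canonical (totally degenerate) if integrating out any
one variable gives `0` almost everywhere. -/
def Canonical (μ : Measure X) (m : ℕ) (h : (Fin m → X) → ℝ) : Prop :=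
  ∀ l : Fin m, ∀ᵐ x ∂ pm μ m, ∫ y, h (Function.update x l y) ∂μ = 0

/-- A kernel of `d` variables is symmetric if it is a.e. invariant under permutations of
its variables. -/
def Symm (μ : Measure X) (d : ℕ) (h : (Fin d → X) → ℝ) : Prop :=
  ∀ σ : Equiv.Perm (Fin d), ∀ᵐ x ∂ pm μ d, h (x ∘ σ) = h x

end VonMises

namespace VonMises

section Helpers

variable {X : Type} [MeasurableSpace X] {μ : Measure X} [IsProbabilityMeasure μ]
  {T : X → X}

/-- The Koopman operator on `L_q`. -/
def koop (q : ℝ≥0∞) [Fact (1 ≤ q)] (hT : MeasurePreserving T μ μ) : Lp ℝ q μ →ₗᵢ[ℝ] Lp ℝ q μ :=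
  Lp.compMeasurePreservingₗᵢ ℝ T hT

lemma koop_coe (q : ℝ≥0∞) [Fact (1 ≤ q)] (hT : MeasurePreserving T μ μ) (f : Lp ℝ q μ) :
    (koop q hT f : X → ℝ) =ᵐ[μ] fun x => (f : X → ℝ) (T x) :=
  Lp.coeFn_compMeasurePreserving f hT

lemma koop_iter (q : ℝ≥0∞) [Fact (1 ≤ q)] (hT : MeasurePreserving T μ μ) (f : Lp ℝ q μ) (k : ℕ) :
    (((koop q hT)^[k] f : Lp ℝ q μ) : X → ℝ) =ᵐ[μ] fun x => (f : X → ℝ) (T^[k] x) := by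
  induction k with
  | zero => simp
  | succ k ih =>
    rw [Function.iterate_succ_apply']
    refine (koop_coe q hT _).trans ?_
    have := hT.quasiMeasurePreserving.ae_eq_comp ih
    filter_upwards [this] with x hx
    simpa [Function.comp, Function.iterate_succ_apply] using hx

lemma koop_iter_norm (q : ℝ≥0∞) [Fact (1 ≤ q)] (hT : MeasurePreserving T μ μ) (f : Lp ℝ q μ)
    (k : ℕ) : ‖(koop q hT)^[k] f‖ = ‖f‖ := by
  induction k with
  | zero => simp
  | succ k ih => rw [Function.iterate_succ_apply', LinearIsometry.norm_map, ih]

lemma avg_coe (q : ℝ≥0∞) [Fact (1 ≤ q)] (hT : MeasurePreserving T μ μ) (f : Lp ℝ q μ) (n : ℕ) :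
    ((birkhoffAverage ℝ (koop q hT) id n f : Lp ℝ q μ) : X → ℝ) =ᵐ[μ] birkhoffAverage ℝ T (f : X → ℝ) n := by
  have h1 : ∀ᵐ x ∂μ, ∀ k, (((koop q hT)^[k] f : Lp ℝ q μ) : X → ℝ) x = (f : X → ℝ) (T^[k] x) :=
    ae_all_iff.2 fun k => koop_iter q hT f k
  unfold birkhoffAverage birkhoffSum
  filter_upwards [h1, Lp.coeFn_smul ((n : ℝ)⁻¹) (∑ k ∈ Finset.range n, id ((koop q hT)^[k] f)),
    Lp.coeFn_finsetSum (Finset.range n) (fun k => id ((koop q hT)^[k] f))] with x h1 h2 h3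
  rw [h2, Pi.smul_apply, h3, Finset.sum_apply]
  simp [h1]

lemma avg_dist_le (q : ℝ≥0∞) [Fact (1 ≤ q)] (hT : MeasurePreserving T μ μ) (f g : Lp ℝ q μ)
    (n : ℕ) : dist (birkhoffAverage ℝ (koop q hT) id n f) (birkhoffAverage ℝ (koop q hT) id n g)
      ≤ dist f g := by
  refine (dist_birkhoffAverage_birkhoffAverage_le ℝ _ _ _ _ _).trans ?_
  have : ∀ k, dist (id ((koop q hT)^[k] f)) (id ((koop q hT)^[k] g)) = dist f g := fun k => by
    rw [dist_eq_norm, dist_eq_norm, ← koop_iter_norm q hT (f - g) k]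
    simp [iterate_map_sub]
  simp only [this, Finset.sum_const, Finset.card_range, nsmul_eq_mul]
  rcases eq_or_ne n 0 with hn | hn
  · simp [hn]
  · rw [mul_div_cancel_left₀]
    exact_mod_cast hn

lemma avg_indicator (q : ℝ≥0∞) [Fact (1 ≤ q)] (hq : q ≠ ∞) (hT : MeasurePreserving T μ μ)
    (c : ℝ) {s : Set X} (hs : MeasurableSet s) (hμs : μ s ≠ ∞) :
    CauchySeq (fun n => birkhoffAverage ℝ (koop q hT) id n (indicatorConstLp q hs hμs c)) := by
  obtain ⟨h, hh⟩ : ∃ h : Lp ℝ 2 μ, Tendsto (fun n => birkhoffAverage ℝ (koop 2 hT) id n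
      (indicatorConstLp 2 hs hμs c)) atTop (𝓝 h) :=
    ⟨_, ContinuousLinearMap.tendsto_birkhoffAverage_orthogonalProjection (𝕜 := ℝ)
      (koop 2 hT).toContinuousLinearMap (LinearIsometry.norm_toContinuousLinearMap_le _) _⟩
  set F : ℕ → X → ℝ := fun n => birkhoffAverage ℝ T (s.indicator fun _ => c) n with hF
  have hFq : ∀ (r : ℝ≥0∞) [Fact (1 ≤ r)] (n : ℕ), ((birkhoffAverage ℝ (koop r hT) id n
      (indicatorConstLp r hs hμs c) : Lp ℝ r μ) : X → ℝ) =ᵐ[μ] F n := fun r _ n =>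
    (avg_coe r hT _ n).trans
      (hT.quasiMeasurePreserving.birkhoffAverage_ae_eq_of_ae_eq ℝ indicatorConstLp_coeFn n)
  have hFb : ∀ n x, ‖F n x‖ ≤ ‖c‖ := by
    intro n x
    simp only [hF, birkhoffAverage, birkhoffSum]
    rw [norm_smul, norm_inv, Real.norm_natCast]
    have : ‖∑ k ∈ Finset.range n, s.indicator (fun _ => c) (T^[k] x)‖ ≤ n * ‖c‖ := by
      have hb : ∀ k ∈ Finset.range n, ‖s.indicator (fun _ => c) (T^[k] x)‖ ≤ ‖c‖ := fun k _ =>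
        norm_indicator_le_norm_self (fun _ => c) _
      exact (norm_sum_le_of_le _ hb).trans (by simp)
    rcases eq_or_ne n 0 with hn | hn
    · simp [hn]
    · rw [inv_mul_le_iff₀ (by positivity)]
      exact this
  have hFm : ∀ n, AEStronglyMeasurable (F n) μ := fun n =>
    (Lp.aestronglyMeasurable _).congr (hFq 2 n)
  have hmeas : TendstoInMeasure μ F atTop h :=
    (tendstoInMeasure_of_tendsto_Lp hh).congr (fun n => hFq 2 n) EventuallyEq.rfl
  obtain ⟨ns, -, hns⟩ := hmeas.exists_seq_tendsto_ae
  have hhb : ∀ᵐ x ∂μ, ‖(h : X → ℝ) x‖ ≤ ‖c‖ := by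
    filter_upwards [hns] with x hx
    exact le_of_tendsto hx.norm (Eventually.of_forall fun i => hFb _ _)
  have hhq : MemLp (h : X → ℝ) q μ := MemLp.of_bound (Lp.aestronglyMeasurable h) ‖c‖ hhb
  have hui : UnifIntegrable F q μ := by
    refine unifIntegrable_of Fact.out hq hFm fun ε hε => ⟨‖c‖₊ + 1, fun i => ?_⟩
    have : ({ x | ‖c‖₊ + 1 ≤ ‖F i x‖₊ }.indicator (F i)) = 0 := by
      ext x
      refine Set.indicator_of_notMem ?_ _
      simp only [Set.mem_ofPred_eq, not_le]
      exact lt_of_le_of_lt (hFb i x) (lt_add_one _)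
    rw [this]
    simp
  have := tendsto_Lp_finite_of_tendstoInMeasure Fact.out hq hFm hhq hui hmeas
  refine Tendsto.cauchySeq (x := hhq.toLp _) ?_
  rw [Lp.tendsto_Lp_iff_tendsto_eLpNorm']
  refine this.congr fun n => eLpNorm_congr_ae ?_
  exact (hFq q n).symm.sub hhq.coeFn_toLp.symm

lemma avg_cauchy (q : ℝ≥0∞) [Fact (1 ≤ q)] (hq : q ≠ ∞) (hT : MeasurePreserving T μ μ)
    (f : Lp ℝ q μ) : CauchySeq (fun n => birkhoffAverage ℝ (koop q hT) id n f) := by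
  induction f using Lp.induction hq with
  | indicatorConst c hs hμs => exact avg_indicator q hq hT c hs hμs.ne
  | add hf hg _ h1 h2 =>
    have := h1.add h2
    convert this using 2 with n
    simp [birkhoffAverage, birkhoffSum, iterate_map_add, Finset.sum_add_distrib]
  | isClosed =>
    rw [← closure_subset_iff_isClosed]
    intro f hf
    rw [Set.mem_ofPred_eq, Metric.cauchySeq_iff]
    intro ε hε
    obtain ⟨g, hg, hfg⟩ := Metric.mem_closure_iff.1 hf (ε / 3) (by positivity)
    obtain ⟨N, hN⟩ := Metric.cauchySeq_iff.1 hg (ε / 3) (by positivity)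
    refine ⟨N, fun m hm n hn => ?_⟩
    have h1 := hN m hm n hn
    have h2 := avg_dist_le q hT f g m
    have h3 := avg_dist_le q hT f g n
    have h4 := dist_triangle4 (birkhoffAverage ℝ (koop q hT) id m f)
      (birkhoffAverage ℝ (koop q hT) id m g) (birkhoffAverage ℝ (koop q hT) id n g)
      (birkhoffAverage ℝ (koop q hT) id n f)
    rw [dist_comm (birkhoffAverage ℝ (koop q hT) id n g)] at h4
    linarith

lemma invariants_le (hT : MeasurePreserving T μ μ) : invariants T ≤ ‹MeasurableSpace X› :=
  fun _ hs => hs.1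

lemma aesm_invariants (hT : MeasurePreserving T μ μ) {g : X → ℝ} (hg : AEStronglyMeasurable g μ)
    (hinv : (fun x => g (T x)) =ᵐ[μ] g) : AEStronglyMeasurable[invariants T] g μ := by
  set g0 := hg.mk g with hg0
  have hgm : Measurable g0 := hg.stronglyMeasurable_mk.measurable
  have h0 : g =ᵐ[μ] g0 := hg.ae_eq_mk
  set u : X → ℝ := fun x => limsup (fun n => g0 (T^[n] x)) atTop with hu
  have hum : Measurable u := Measurable.limsup fun n => hgm.comp (hT.measurable.iterate n)
  have huT : ∀ x, u (T x) = u x := by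
    intro x
    have := Filter.limsup_nat_add (fun n => g0 (T^[n] x)) 1
    simpa [hu, Function.iterate_succ_apply] using this
  have hum' : Measurable[invariants T] u := by
    intro s hs
    refine ⟨hum hs, ?_⟩
    ext x
    simp [huT]
  refine ⟨u, hum'.stronglyMeasurable, ?_⟩
  have hk : ∀ k : ℕ, (fun x => g (T^[k] x)) =ᵐ[μ] g := by
    intro k
    induction k with
    | zero => simp
    | succ k ih =>
      have := (hT.quasiMeasurePreserving.ae_eq_comp ih)
      refine EventuallyEq.trans ?_ hinv
      filter_upwards [this] with x hx
      simpa [Function.iterate_succ_apply] using hx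
  have hk0 : ∀ᵐ x ∂μ, ∀ k : ℕ, g0 (T^[k] x) = g x := by
    refine ae_all_iff.2 fun k => ?_
    filter_upwards [hk k, (hT.iterate k).quasiMeasurePreserving.ae_eq_comp h0] with x h1 h2
    rw [← h1]
    exact h2.symm
  filter_upwards [hk0] with x hx
  simp [hu, hx]

lemma setIntegral_avg (q : ℝ≥0∞) [Fact (1 ≤ q)] (hT : MeasurePreserving T μ μ)
    (f : Lp ℝ q μ) {s : Set X} (hs : MeasurableSet[invariants T] s) {n : ℕ} (hn : n ≠ 0) :
    ∫ x in s, ((birkhoffAverage ℝ (koop q hT) id n f : Lp ℝ q μ) : X → ℝ) x ∂μ = ∫ x in s, (f : X → ℝ) x ∂μ := by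
  have hfi : Integrable (f : X → ℝ) μ := (Lp.memLp f).integrable Fact.out
  have hsk : ∀ k, T^[k] ⁻¹' s = s := by
    intro k
    induction k with
    | zero => simp
    | succ k ih => rw [Function.iterate_succ, Set.preimage_comp, ih, hs.2]
  have hk : ∀ k, ∫ x in s, (f : X → ℝ) (T^[k] x) ∂μ = ∫ x in s, (f : X → ℝ) x ∂μ := by
    intro k
    have hTk := hT.iterate k
    have := setIntegral_map (μ := μ) (g := T^[k]) (f := (f : X → ℝ)) hs.1
      (by rw [hTk.map_eq]; exact hfi.1) hTk.aemeasurable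
    rw [hTk.map_eq, hsk] at this
    exact this.symm
  rw [integral_congr_ae (ae_restrict_of_ae (avg_coe q hT f n))]
  simp only [birkhoffAverage, birkhoffSum]
  rw [integral_smul, integral_finsetSum]
  · simp only [hk]
    simp [hn]
  · intro k _
    exact ((hT.iterate k).integrable_comp_of_integrable hfi).integrableOn

lemma avg_tendsto (q : ℝ≥0∞) [Fact (1 ≤ q)] (hq : q ≠ ∞) (hT : MeasurePreserving T μ μ)
    (f : Lp ℝ q μ) : ∃ g : Lp ℝ q μ, (g : X → ℝ) =ᵐ[μ] μ[(f : X → ℝ) | invariants T] ∧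
      Tendsto (fun n => birkhoffAverage ℝ (koop q hT) id n f) atTop (𝓝 g) := by
  obtain ⟨g, hg⟩ := cauchySeq_tendsto_of_complete (avg_cauchy q hq hT f)
  refine ⟨g, ?_, hg⟩
  have hfi : Integrable (f : X → ℝ) μ := (Lp.memLp f).integrable Fact.out
  have hgi : Integrable (g : X → ℝ) μ := (Lp.memLp g).integrable Fact.out
  refine ae_eq_condExp_of_forall_setIntegral_eq (invariants_le hT) hfi
    (fun s _ _ => hgi.integrableOn) (fun s hs _ => ?_) ?_
  · have hL := (Lp.tendsto_Lp_iff_tendsto_eLpNorm' _ _).1 hg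
    have hL1 : Tendsto (fun n => eLpNorm
        (⇑(birkhoffAverage ℝ (koop q hT) id n f) - ⇑g) 1 μ) atTop (𝓝 0) :=
      tendsto_of_tendsto_of_tendsto_of_le_of_le tendsto_const_nhds hL (fun _ => zero_le)
        (fun n => eLpNorm_le_eLpNorm_of_exponent_le Fact.out
          ((Lp.aestronglyMeasurable _).sub (Lp.aestronglyMeasurable _)))
    have := tendsto_setIntegral_of_L1' (g : X → ℝ) hgi.1
      (Eventually.of_forall fun n => (Lp.memLp (birkhoffAverage ℝ (koop q hT) id n f)).integrable
        Fact.out) hL1 s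
    refine tendsto_nhds_unique this (tendsto_const_nhds.congr' ?_)
    filter_upwards [eventually_ne_atTop 0] with n hn
    exact (setIntegral_avg q hT f hs hn).symm
  · refine aesm_invariants hT hgi.1 ?_
    have h1 : Tendsto (fun n => koop q hT (birkhoffAverage ℝ (koop q hT) id n f)
        - birkhoffAverage ℝ (koop q hT) id n f) atTop (𝓝 0) := by
      have := tendsto_birkhoffAverage_apply_sub_birkhoffAverage ℝ (f := koop q hT) (g := id)
        (x := f) (isBounded_iff_forall_norm_le.2 ⟨‖f‖, Set.forall_mem_range.2 fun n =>
          (koop_iter_norm q hT f n).le⟩)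
      refine this.congr fun n => ?_
      congr 1
      simp only [birkhoffAverage, birkhoffSum, map_smul, map_sum, id]
      simp only [← Function.iterate_succ_apply, ← Function.iterate_succ_apply']
    have h2 := (((koop q hT).continuous.tendsto g).comp hg).sub hg
    have h3 : koop q hT g = g := sub_eq_zero.1 (tendsto_nhds_unique h2 h1)
    refine (koop_coe q hT g).symm.trans ?_
    rw [h3]

end Helpers

/-- Remark 4, multiple statistical ergodic theorem: for
`d ≥ 2`, `p_1,…,p_d, r ∈ (1,∞)` with `Σ 1/p_i = 1/r`, the averaged tensor Koopman
operators converge in the strong operator topology on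
`L_{p_1}(μ) ⊗̂_π ⋯ ⊗̂_π L_{p_d}(μ)` to `E_{inv,1} ⊗_π ⋯ ⊗_π E_{inv,d}`. -/
theorem statement6
    {X : Type} [MeasurableSpace X] [StandardBorelSpace X]
    (μ : Measure X) [IsProbabilityMeasure μ]
    (d : ℕ) (hd : 2 ≤ d)
    (p : Fin d → ℝ≥0∞) [∀ i, Fact (1 ≤ p i)] (r : ℝ≥0∞)
    (hp1 : ∀ i, 1 < p i) (hp2 : ∀ i, p i ≠ ∞) (hr1 : 1 < r) (hr2 : r ≠ ∞)
    (hpr : ∑ i, (p i)⁻¹ = r⁻¹)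
    (T : Fin d → X → X) (hT : ∀ i, MeasurePreserving (T i) μ μ)
    (E : Type) [NormedAddCommGroup E] [NormedSpace ℝ E] [CompleteSpace E]
    (tp : ContinuousMultilinearMap ℝ (fun i : Fin d => Lp ℝ (p i) μ) E)
    (hE : IsPTP μ p E tp)
    (W : (Fin d → ℕ) → E →L[ℝ] E)
    (hW : ∀ k, IsTKoop μ p tp T k (W k))
    (Winv : E →L[ℝ] E) (hWinv : IsTCondexpInv μ p tp T Winv) :
    ∀ f : E,
      Tendsto (fun n : Fin d → ℕ =>
          (∏ i, (n i : ℝ))⁻¹ •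
            ∑ k ∈ Fintype.piFinset (fun i => Finset.range (n i)), W k f)
        atTop (𝓝 (Winv f)) := by
  -- the operators `W k` are contractions
  have hWn : ∀ k, ‖W k‖ ≤ 1 := by
    intro k
    let V : ∀ i, Lp ℝ (p i) μ →L[ℝ] Lp ℝ (p i) μ := fun i =>
      (koop (p i) ((hT i).iterate (k i))).toContinuousLinearMap
    obtain ⟨L, hL, hLn⟩ := hE.lift E (tp.compContinuousLinearMap V)
    have hWL : W k = L := by
      refine ContinuousLinearMap.ext_on hE.denseSpan ?_
      rintro _ ⟨f, rfl⟩
      rw [hL]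
      exact hW k f _ fun i => koop_coe (p i) ((hT i).iterate (k i)) (f i)
    rw [hWL, hLn]
    refine ContinuousMultilinearMap.opNorm_le_bound zero_le_one fun f => ?_
    rw [ContinuousMultilinearMap.compContinuousLinearMap_apply, hE.crossNorm, one_mul]
    refine (Finset.prod_congr rfl fun i _ => ?_).le
    exact (koop (p i) ((hT i).iterate (k i))).norm_map (f i)
  have hWinvn : ∀ n : Fin d → ℕ, ∀ f : E, ‖(∏ i, (n i : ℝ))⁻¹ •
      ∑ k ∈ Fintype.piFinset (fun i => Finset.range (n i)), W k f‖ ≤ ‖f‖ := by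
    intro n f
    have h1 : ‖∑ k ∈ Fintype.piFinset (fun i => Finset.range (n i)), W k f‖
        ≤ (∏ i, (n i : ℝ)) * ‖f‖ := by
      have hb : ∀ k ∈ Fintype.piFinset (fun i => Finset.range (n i)), ‖W k f‖ ≤ ‖f‖ := fun k _ => by
        simpa using (W k).le_of_opNorm_le (hWn k) f
      exact (norm_sum_le_of_le _ hb).trans (by simp)
    have h0 : 0 ≤ ∏ i, (n i : ℝ) := Finset.prod_nonneg fun i _ => Nat.cast_nonneg _
    rw [norm_smul, norm_inv, Real.norm_of_nonneg h0]
    rcases h0.eq_or_lt with h | h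
    · rw [← h]; simp
    · rwa [inv_mul_le_iff₀ h]
  -- convergence on elementary tensors
  have htp : ∀ f : ∀ i, Lp ℝ (p i) μ, Tendsto (fun n : Fin d → ℕ =>
          (∏ i, (n i : ℝ))⁻¹ •
            ∑ k ∈ Fintype.piFinset (fun i => Finset.range (n i)), W k (tp f))
        atTop (𝓝 (Winv (tp f))) := by
    intro f
    choose g hg1 hg2 using fun i => avg_tendsto (p i) (hp2 i) (hT i) (f i)
    rw [hWinv f g hg1]
    have h1 : Tendsto (fun n : Fin d → ℕ => tp fun i =>
        birkhoffAverage ℝ (koop (p i) (hT i)) id (n i) (f i)) atTop (𝓝 (tp g)) := by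
      refine (tp.cont.tendsto g).comp (tendsto_pi_nhds.2 fun i => (hg2 i).comp ?_)
      exact Monotone.tendsto_atTop_atTop (fun a b h => h i) fun b => ⟨fun _ => b, le_rfl⟩
    refine h1.congr fun n => ?_
    simp only [birkhoffAverage, birkhoffSum, id]
    rw [ContinuousMultilinearMap.map_smul_univ, ContinuousMultilinearMap.map_sum_finset,
      Finset.prod_inv_distrib]
    congr 1
    refine Finset.sum_congr rfl fun k _ => ?_
    exact (hW k f _ fun i => koop_iter (p i) (hT i) (f i) (k i)).symm
  -- convergence on the span
  have hspan : ∀ f ∈ Submodule.span ℝ (Set.range fun f : ∀ i : Fin d, Lp ℝ (p i) μ => tp f),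
      Tendsto (fun n : Fin d → ℕ =>
          (∏ i, (n i : ℝ))⁻¹ •
            ∑ k ∈ Fintype.piFinset (fun i => Finset.range (n i)), W k f)
        atTop (𝓝 (Winv f)) := by
    intro f hf
    induction hf using Submodule.span_induction with
    | mem x hx => obtain ⟨f, rfl⟩ := hx; exact htp f
    | zero => simp
    | add x y _ _ hx hy =>
      simpa [Finset.sum_add_distrib, smul_add] using hx.add hy
    | smul a x _ hx =>
      have := hx.const_smul a
      simp only [map_smul, ← Finset.smul_sum]
      refine this.congr fun n => smul_comm _ _ _
  -- density
  intro f
  rw [Metric.tendsto_nhds]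
  intro ε hε
  have hδ : 0 < ε / (2 + ‖Winv‖) := by positivity
  obtain ⟨g, hg, hfg⟩ := Metric.mem_closure_iff.1 (hE.denseSpan f) _ hδ
  have hfg' : dist f g * (2 + ‖Winv‖) < ε := by
    rwa [lt_div_iff₀ (by positivity)] at hfg
  have hηpos : 0 < ε - dist f g * (2 + ‖Winv‖) := by linarith
  filter_upwards [Metric.tendsto_nhds.1 (hspan g hg) _ hηpos] with n hn
  have h1 := hWinvn n (f - g)
  simp only [map_sub, Finset.sum_sub_distrib, smul_sub] at h1
  rw [← dist_eq_norm, ← dist_eq_norm] at h1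
  have h2 : dist (Winv g) (Winv f) ≤ ‖Winv‖ * dist f g := by
    rw [dist_comm f g]
    exact Winv.dist_le_opNorm g f
  have h5 := dist_triangle4 ((∏ i, (n i : ℝ))⁻¹ •
            ∑ k ∈ Fintype.piFinset (fun i => Finset.range (n i)), W k f) ((∏ i, (n i : ℝ))⁻¹ •
            ∑ k ∈ Fintype.piFinset (fun i => Finset.range (n i)), W k g) (Winv g) (Winv f)
  have h6 : 0 ≤ dist f g := dist_nonneg
  nlinarith

end VonMises
end
end

section
/- Let r = p/d for an integer d ≥ 2 and a real p ≥ d. Let T be an ergodic measure preserving transformation of the probability space (X,𝓕,μ) and f ∈ L_{p,π}(μ^d). Then, as n → ∞, the normalized von Mises statistic (1/n^d) Σ_{0 ≤ k_1,…,k_d ≤ n−1} D_d V^{(k_1,…,k_d)} f converges μ-almost surely and in L_r(μ) to the constant ∫_{X^d} (J_d f)(x_1,…,x_d) μ(dx_1)⋯μ(dx_d). -/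
open MeasureTheory Filter Topology ENNReal ProbabilityTheory

noncomputable section

namespace VonMises

section Birkhoff

set_option linter.unusedSectionVars false

variable {X : Type} [MeasurableSpace X]

/-- Maximum of `0, S_1 f, …, S_N f`. -/
def maxSum (T : X → X) (f : X → ℝ) : ℕ → X → ℝ
  | 0 => fun _ => 0
  | N + 1 => fun x => max 0 (f x + maxSum T f N (T x))

lemma maxSum_nonneg (T : X → X) (f : X → ℝ) (N : ℕ) (x : X) : 0 ≤ maxSum T f N x := by
  cases N with
  | zero => exact le_refl _
  | succ N => exact le_max_left _ _

lemma maxSum_le_succ (T : X → X) (f : X → ℝ) (N : ℕ) :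
    ∀ x, maxSum T f N x ≤ maxSum T f (N + 1) x := by
  induction N with
  | zero => intro x; exact maxSum_nonneg _ _ _ _
  | succ N ih =>
    intro x
    have := ih (T x)
    simp only [maxSum] at this ⊢
    gcongr

lemma maxSum_mono (T : X → X) (f : X → ℝ) (x : X) : Monotone (fun N => maxSum T f N x) :=
  monotone_nat_of_le_succ fun N => maxSum_le_succ T f N x

lemma birkhoffSum_le_maxSum' (T : X → X) (f : X → ℝ) (N : ℕ) :
    ∀ x, birkhoffSum T f N x ≤ maxSum T f N x := by
  induction N with
  | zero => intro x; simp [maxSum]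
  | succ N ih =>
    intro x
    rw [birkhoffSum_succ']
    exact le_trans (by have := ih (T x); linarith) (le_max_right _ _)

lemma birkhoffSum_le_maxSum (T : X → X) (f : X → ℝ) {n N : ℕ} (h : n ≤ N) (x : X) :
    birkhoffSum T f n x ≤ maxSum T f N x :=
  (birkhoffSum_le_maxSum' T f n x).trans (maxSum_mono T f x h)

variable {μ : Measure X}

lemma maxSum_measurable {T : X → X} (hT : Measurable T) {f : X → ℝ} (hf : Measurable f) (N : ℕ) :
    Measurable (maxSum T f N) := by
  induction N with
  | zero => exact measurable_const
  | succ N ih => exact measurable_const.max (hf.add (ih.comp hT))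

lemma maxSum_integrable [IsFiniteMeasure μ] {T : X → X} (hT : MeasurePreserving T μ μ) {f : X → ℝ}
    (hf : Integrable f μ) (N : ℕ) :
    Integrable (maxSum T f N) μ := by
  induction N with
  | zero => exact integrable_const _
  | succ N ih =>
    exact (integrable_const (0 : ℝ)).sup (hf.add (hT.integrable_comp_of_integrable ih))

lemma integral_comp_mp {T : X → X} (hT : MeasurePreserving T μ μ) {g : X → ℝ}
    (hg : AEStronglyMeasurable g μ) : ∫ x, g (T x) ∂μ = ∫ x, g x ∂μ := by
  conv_rhs => rw [← hT.map_eq]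
  rw [integral_map hT.aemeasurable (by rwa [hT.map_eq])]

/-- maximal ergodic theorem -/
lemma maximal_ergodic [IsFiniteMeasure μ] {T : X → X} (hT : MeasurePreserving T μ μ) {f : X → ℝ}
    (hfm : Measurable f) (hf : Integrable f μ) (N : ℕ) :
    0 ≤ ∫ x in {x | 0 < maxSum T f N x}, f x ∂μ := by
  have hms : MeasurableSet {x | 0 < maxSum T f N x} :=
    measurableSet_lt measurable_const (maxSum_measurable hT.measurable hfm N)
  rw [← integral_indicator hms]
  have hi := maxSum_integrable hT hf N
  have hiT : Integrable (fun x => maxSum T f N (T x)) μ := hT.integrable_comp_of_integrable hi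
  have h1 : ∫ x, maxSum T f N x ∂μ ≤
      ∫ x, ({x | 0 < maxSum T f N x}.indicator f x + maxSum T f N (T x)) ∂μ := by
    refine integral_mono hi ((hf.indicator hms).add hiT) ?_
    intro x
    by_cases hx : 0 < maxSum T f N x
    · simp only [Set.indicator, Set.mem_ofPred_eq, hx, if_true]
      cases N with
      | zero => exact absurd hx (lt_irrefl _)
      | succ N =>
        have h2 := maxSum_le_succ T f N (T x)
        rcases le_total (f x + maxSum T f N (T x)) 0 with h | h
        · have : maxSum T f (N + 1) x = 0 := max_eq_left h
          linarith
        · have : maxSum T f (N + 1) x = f x + maxSum T f N (T x) := max_eq_right h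
          linarith
    · simp only [Set.indicator, Set.mem_ofPred_eq, hx, if_false]
      have := maxSum_nonneg T f N (T x)
      linarith
  rw [integral_add (hf.indicator hms) hiT, integral_comp_mp hT hi.1] at h1
  linarith

lemma ae_bdd_of_integral_neg [IsProbabilityMeasure μ] {T : X → X} (hE : Ergodic T μ)
    {f : X → ℝ} (hfm : Measurable f) (hf : Integrable f μ) (hneg : ∫ x, f x ∂μ < 0) :
    ∀ᵐ x ∂μ, ∃ C, ∀ n, birkhoffSum T f n x ≤ C := by
  have hT := hE.toMeasurePreserving
  set A : Set X := {x | ∃ C : ℕ, ∀ N, maxSum T f N x ≤ C} with hA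
  have hAm : MeasurableSet A := by
    have : A = ⋃ C : ℕ, ⋂ N, {x | maxSum T f N x ≤ C} := by ext x; simp [hA]
    rw [this]
    exact MeasurableSet.iUnion fun C => MeasurableSet.iInter fun N =>
      measurableSet_le (maxSum_measurable hT.measurable hfm N) measurable_const
  have hAi : T ⁻¹' A = A := by
    ext x
    constructor
    · rintro ⟨C, hC⟩
      obtain ⟨C', hC'⟩ := exists_nat_ge (max 0 (f x + C))
      refine ⟨C', fun N => ?_⟩
      refine (maxSum_le_succ T f N x).trans (le_trans ?_ hC')
      have := hC N
      simp only [maxSum]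
      gcongr
    · rintro ⟨C, hC⟩
      obtain ⟨C', hC'⟩ := exists_nat_ge (C - f x)
      refine ⟨C', fun N => le_trans ?_ hC'⟩
      have h1 := hC (N + 1)
      have h2 : f x + maxSum T f N (T x) ≤ maxSum T f (N + 1) x := le_max_right _ _
      linarith
  rcases hE.toPreErgodic.ae_empty_or_univ hAm hAi with h | h
  · exfalso
    have hae : ∀ᵐ x ∂μ, x ∉ A := by
      filter_upwards [h] with x hx hxA
      exact (hx.mp hxA : x ∈ (∅ : Set X))
    have haeT : ∀ᵐ x ∂μ, T x ∉ A := by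
      filter_upwards [hae] with x hx hxA
      exact hx (hAi ▸ hxA : x ∈ A)
    have hlim : Tendsto (fun N => ∫ x, max (-maxSum T f N (T x)) (f x) ∂μ) atTop
        (𝓝 (∫ x, f x ∂μ)) := by
      refine tendsto_integral_of_dominated_convergence (fun x => |f x|) ?_ hf.abs ?_ ?_
      · intro N
        exact (((maxSum_measurable hT.measurable hfm N).comp
          hT.measurable).neg.max hfm).aestronglyMeasurable
      · intro N
        refine ae_of_all _ fun x => ?_
        rw [Real.norm_eq_abs, abs_le]
        have := maxSum_nonneg T f N (T x)
        refine ⟨(neg_abs_le _).trans (le_max_right _ _), max_le ?_ (le_abs_self _)⟩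
        linarith [abs_nonneg (f x)]
      · filter_upwards [haeT] with x hx
        refine tendsto_const_nhds.congr' ?_
        have : ∃ N, -f x ≤ maxSum T f N (T x) := by
          by_contra! hcon
          obtain ⟨C, hC⟩ := exists_nat_ge (-f x)
          exact hx ⟨C, fun N => (hcon N).le.trans hC⟩
        obtain ⟨N, hN⟩ := this
        filter_upwards [eventually_ge_atTop N] with n hn
        have := maxSum_mono T f (T x) hn
        simp only at this
        rw [max_eq_right]; linarith
    refine absurd (ge_of_tendsto' hlim (b := 0) fun N => ?_) (not_le.mpr hneg)
    have hi := maxSum_integrable hT hf N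
    have hiT : Integrable (fun x => maxSum T f N (T x)) μ := hT.integrable_comp_of_integrable hi
    have hi1 := maxSum_integrable hT hf (N + 1)
    have : ∀ x, max (-maxSum T f N (T x)) (f x) = maxSum T f (N + 1) x - maxSum T f N (T x) := by
      intro x
      simp only [maxSum]
      rw [← max_sub_sub_right]; simp
    simp_rw [this]
    rw [integral_sub hi1 hiT, integral_comp_mp hT hi.1]
    have := integral_mono hi hi1 (maxSum_le_succ T f N)
    linarith
  · filter_upwards [h] with x hx
    obtain ⟨C, hC⟩ : x ∈ A := hx.mpr trivial
    exact ⟨C, fun n => (birkhoffSum_le_maxSum' T f n x).trans (hC n)⟩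

lemma birkhoffSum_sub_const (T : X → X) (f : X → ℝ) (c : ℝ) (n : ℕ) (x : X) :
    birkhoffSum T (fun y => f y - c) n x = birkhoffSum T f n x - n * c := by
  simp [birkhoffSum]

lemma birkhoff_upper [IsProbabilityMeasure μ] {T : X → X} (hE : Ergodic T μ)
    {f : X → ℝ} (hfm : Measurable f) (hf : Integrable f μ) :
    ∀ᵐ x ∂μ, ∀ c, ∫ x, f x ∂μ < c → ∀ᶠ n : ℕ in atTop, (n : ℝ)⁻¹ * birkhoffSum T f n x < c := by
  have key : ∀ q : ℚ, ∀ᵐ x ∂μ, ∫ x, f x ∂μ < q → ∃ C, ∀ n, birkhoffSum T f n x - n * q ≤ C := by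
    intro q
    by_cases hq : ∫ x, f x ∂μ < q
    · have := ae_bdd_of_integral_neg (f := fun y => f y - (q : ℝ)) hE (hfm.sub_const _)
        (hf.sub (integrable_const _))
        (by rw [integral_sub hf (integrable_const _)]; simp; linarith)
      filter_upwards [this] with x hx _
      simpa only [birkhoffSum_sub_const] using hx
    · exact ae_of_all _ fun x h => absurd h hq
  filter_upwards [ae_all_iff.2 key] with x hx c hc
  obtain ⟨q, hq1, hq2⟩ := exists_rat_btwn hc
  obtain ⟨C, hC⟩ := hx q hq1
  have h1 : Tendsto (fun n : ℕ => (n : ℝ)⁻¹ * C + q) atTop (𝓝 (0 * C + q)) :=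
    (tendsto_inv_atTop_nhds_zero_nat.mul_const C).add_const _
  have h2 := h1.eventually_lt_const (u := c) (by simpa using hq2)
  filter_upwards [h2, eventually_gt_atTop 0] with n hn hn0
  refine lt_of_le_of_lt ?_ hn
  have hn0' : (0 : ℝ) < n := by exact_mod_cast hn0
  have := hC n
  have h3 : birkhoffSum T f n x ≤ C + n * q := by linarith
  calc (n : ℝ)⁻¹ * birkhoffSum T f n x ≤ (n : ℝ)⁻¹ * (C + n * q) := by gcongr
    _ = _ := by field_simp

/-- Birkhoff's pointwise ergodic theorem for ergodic transformations. -/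
lemma birkhoff_ergodic [IsProbabilityMeasure μ] {T : X → X} (hE : Ergodic T μ)
    {f : X → ℝ} (hfm : Measurable f) (hf : Integrable f μ) :
    ∀ᵐ x ∂μ, Tendsto (fun n : ℕ => (n : ℝ)⁻¹ * birkhoffSum T f n x) atTop
      (𝓝 (∫ x, f x ∂μ)) := by
  filter_upwards [birkhoff_upper hE hfm hf, birkhoff_upper hE hfm.neg hf.neg] with x h1 h2
  rw [tendsto_order]
  refine ⟨fun c hc => ?_, fun c hc => h1 c hc⟩
  have := h2 (-c) (by simp only [Pi.neg_apply, integral_neg]; linarith)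
  filter_upwards [this] with n hn
  have e : birkhoffSum T (-f) n x = - birkhoffSum T f n x := by simp [birkhoffSum]
  rw [e] at hn; linarith

/-- The vector of the first `N` ergodic averages. -/
def avgVec (T : X → X) (f : X → ℝ) (N : ℕ) (x : X) : Fin N → ℝ :=
  fun n => ((n : ℕ) : ℝ)⁻¹ * birkhoffSum T f n x

lemma birkhoffSum_measurable {T : X → X} (hT : Measurable T) {f : X → ℝ} (hf : Measurable f)
    (n : ℕ) : Measurable (birkhoffSum T f n) := by
  unfold birkhoffSum
  exact Finset.measurable_sum _ fun k _ => hf.comp (hT.iterate k)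

lemma avgVec_measurable {T : X → X} (hT : Measurable T) {f : X → ℝ} (hf : Measurable f)
    (N : ℕ) : Measurable (avgVec T f N) :=
  measurable_pi_lambda _ fun n => (birkhoffSum_measurable hT hf n).const_mul _

lemma weak_max [IsProbabilityMeasure μ] {T : X → X} (hT : MeasurePreserving T μ μ) {h : X → ℝ}
    (hm : Measurable h) (h0 : ∀ x, 0 ≤ h x) (hi : Integrable h μ) (N : ℕ) {t : ℝ} (ht : 0 < t) :
    ENNReal.ofReal t * μ {x | t < ‖avgVec T h N x‖} ≤ ∫⁻ x, ENNReal.ofReal (h x) ∂μ := by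
  set B := {x | 0 < maxSum T (fun y => h y - t) N x} with hB
  have hBm : MeasurableSet B := measurableSet_lt measurable_const
    (maxSum_measurable hT.measurable (hm.sub_const t) N)
  have hsub : {x | t < ‖avgVec T h N x‖} ⊆ B := by
    intro x hx
    by_contra hcon
    simp only [hB, Set.mem_ofPred_eq, not_lt] at hcon
    have hx' : t < ‖avgVec T h N x‖ := hx
    refine absurd hx' (not_lt.mpr ?_)
    rw [pi_norm_le_iff_of_nonneg ht.le]
    intro n
    have h1 := (birkhoffSum_le_maxSum T (fun y => h y - t) n.2.le x).trans hcon
    rw [birkhoffSum_sub_const] at h1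
    have h2 : 0 ≤ birkhoffSum T h n x := Finset.sum_nonneg fun _ _ => h0 _
    rw [avgVec, Real.norm_eq_abs, abs_of_nonneg (by positivity)]
    rcases Nat.eq_zero_or_pos (n : ℕ) with hn | hn
    · simp [hn, ht.le]
    · rw [inv_mul_le_iff₀ (by exact_mod_cast hn)]; linarith
  have hmax := maximal_ergodic hT (hm.sub_const t) (hi.sub (integrable_const t)) N
  rw [integral_sub hi.integrableOn (integrable_const t).integrableOn] at hmax
  have h3 : t * μ.real B ≤ ∫ x, h x ∂μ := by
    have h4 : ∫ x in B, h x ∂μ ≤ ∫ x, h x ∂μ :=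
      setIntegral_le_integral hi (ae_of_all _ h0)
    simp only [integral_const, smul_eq_mul, measureReal_restrict_apply_univ] at hmax
    rw [mul_comm]; linarith
  calc ENNReal.ofReal t * μ {x | t < ‖avgVec T h N x‖} ≤ ENNReal.ofReal t * μ B := by gcongr
    _ = ENNReal.ofReal (t * μ.real B) := by
      rw [ENNReal.ofReal_mul ht.le, ofReal_measureReal]
    _ ≤ ENNReal.ofReal (∫ x, h x ∂μ) := ENNReal.ofReal_le_ofReal h3
    _ = _ := ofReal_integral_eq_lintegral_ofReal hi (ae_of_all _ h0)

lemma weak_max' [IsProbabilityMeasure μ] {T : X → X} (hT : MeasurePreserving T μ μ) {h : X → ℝ}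
    (hm : Measurable h) (h0 : ∀ x, 0 ≤ h x) (hi : Integrable h μ) (N : ℕ) {t : ℝ} (ht : 0 < t) :
    ENNReal.ofReal (t / 2) * μ {x | t < ‖avgVec T h N x‖} ≤
      (μ.withDensity fun x => ENNReal.ofReal (h x)) {x | t < 2 * h x} := by
  set S := {x | t < 2 * h x} with hS
  have hSm : MeasurableSet S := measurableSet_lt measurable_const (hm.const_mul 2)
  have key := weak_max hT (hm.indicator hSm) (fun x => Set.indicator_nonneg (fun y _ => h0 y) x)
    (hi.indicator hSm) N (half_pos ht)
  have hsub : {x | t < ‖avgVec T h N x‖} ⊆ {x | t / 2 < ‖avgVec T (S.indicator h) N x‖} := by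
    intro x hx
    by_contra hcon
    simp only [Set.mem_ofPred_eq, not_lt] at hcon
    have hx' : t < ‖avgVec T h N x‖ := hx
    refine absurd hx' (not_lt.mpr ?_)
    rw [pi_norm_le_iff_of_nonneg ht.le]
    rw [pi_norm_le_iff_of_nonneg (half_pos ht).le] at hcon
    intro n
    have h1 := (le_abs_self _).trans (hcon n)
    have h2 : 0 ≤ birkhoffSum T h n x := Finset.sum_nonneg fun _ _ => h0 _
    simp only [avgVec] at h1 ⊢
    rw [Real.norm_eq_abs, abs_of_nonneg (by positivity)]
    have h3 : birkhoffSum T h n x - n * (t / 2) ≤ birkhoffSum T (S.indicator h) n x := by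
      rw [← birkhoffSum_sub_const]
      refine Finset.sum_le_sum fun k _ => ?_
      by_cases hk : T^[k] x ∈ S
      · rw [Set.indicator_of_mem hk]; linarith
      · rw [Set.indicator_of_notMem hk]
        simp only [hS, Set.mem_ofPred_eq, not_lt] at hk; linarith
    rcases Nat.eq_zero_or_pos (n : ℕ) with hn | hn
    · simp [hn, ht.le]
    · have hn' : (0 : ℝ) < (n : ℕ) := by exact_mod_cast hn
      rw [inv_mul_le_iff₀ hn'] at h1 ⊢; linarith
  refine (by gcongr : _ ≤ ENNReal.ofReal (t / 2) * _).trans (key.trans (le_of_eq ?_))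
  rw [withDensity_apply _ hSm, ← lintegral_indicator hSm]
  congr 1 with x
  by_cases hx : x ∈ S <;> simp [hx]

lemma strong_max [IsProbabilityMeasure μ] {T : X → X} (hT : MeasurePreserving T μ μ) {h : X → ℝ}
    (hm : Measurable h) (h0 : ∀ x, 0 ≤ h x) (hi : Integrable h μ) (N : ℕ) {p : ℝ} (hp : 1 < p) :
    ∫⁻ x, ENNReal.ofReal (‖avgVec T h N x‖ ^ p) ∂μ ≤
      ENNReal.ofReal (p / (p - 1) * 2 ^ p) * ∫⁻ x, ENNReal.ofReal (h x ^ p) ∂μ := by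
  have hp0 : 0 < p := by linarith
  have hp1 : 0 < p - 1 := by linarith
  set ν := μ.withDensity fun x => ENNReal.ofReal (h x)
  rw [lintegral_rpow_eq_lintegral_meas_lt_mul μ (ae_of_all _ fun x => norm_nonneg _)
    (avgVec_measurable hT.measurable hm N).norm.aemeasurable hp0]
  have e1 := lintegral_rpow_eq_lintegral_meas_lt_mul ν (f := fun x => 2 * h x)
    (ae_of_all _ fun x => mul_nonneg zero_le_two (h0 x))
    (hm.const_mul 2).aemeasurable hp1
  have e2 : ∫⁻ x, ENNReal.ofReal ((2 * h x) ^ (p - 1)) ∂ν =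
      ENNReal.ofReal (2 ^ (p - 1)) * ∫⁻ x, ENNReal.ofReal (h x ^ p) ∂μ := by
    rw [lintegral_withDensity_eq_lintegral_mul _ hm.ennreal_ofReal
      (by fun_prop), ← lintegral_const_mul _ (by fun_prop)]
    congr 1 with x
    simp only [Pi.mul_apply]
    rw [← ENNReal.ofReal_mul (h0 x), ← ENNReal.ofReal_mul (by positivity),
      Real.mul_rpow zero_le_two (h0 x)]
    congr 1
    rcases (h0 x).eq_or_lt with hx | hx
    · rw [← hx, Real.zero_rpow hp0.ne']; simp
    · rw [Real.rpow_sub_one hx.ne']; field_simp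
  have e3 : ∫⁻ t in Set.Ioi 0, μ {a | t < ‖avgVec T h N a‖} * ENNReal.ofReal (t ^ (p - 1)) ≤
      2 * ∫⁻ t in Set.Ioi 0, ν {a | t < 2 * h a} * ENNReal.ofReal (t ^ (p - 1 - 1)) := by
    rw [← lintegral_const_mul' _ _ (by simp)]
    refine setLIntegral_mono' measurableSet_Ioi fun t ht => ?_
    have ht : 0 < t := ht
    have := weak_max' hT hm h0 hi N ht
    have e : ENNReal.ofReal (t ^ (p - 1)) =
        2 * ENNReal.ofReal (t / 2) * ENNReal.ofReal (t ^ (p - 1 - 1)) := by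
      rw [← ENNReal.ofReal_ofNat 2, ← ENNReal.ofReal_mul zero_le_two,
        ← ENNReal.ofReal_mul (by positivity)]
      congr 1
      rw [Real.rpow_sub_one ht.ne' (p - 1)]; field_simp
    calc _ = 2 * ((ENNReal.ofReal (t / 2) * μ {a | t < ‖avgVec T h N a‖}) *
          ENNReal.ofReal (t ^ (p - 1 - 1))) := by rw [e]; ring
      _ ≤ _ := by gcongr
  rw [e2] at e1
  have e4 : ENNReal.ofReal (p / (p - 1) * 2 ^ p) =
      ENNReal.ofReal p * 2 * (ENNReal.ofReal (p - 1))⁻¹ * ENNReal.ofReal (2 ^ (p - 1)) := by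
    rw [← ENNReal.ofReal_inv_of_pos hp1, ← ENNReal.ofReal_ofNat 2, ← ENNReal.ofReal_mul hp0.le,
      ← ENNReal.ofReal_mul (by positivity), ← ENNReal.ofReal_mul (by positivity)]
    congr 1
    rw [Real.rpow_sub_one two_ne_zero]; field_simp
  calc _ ≤ ENNReal.ofReal p * (2 * ∫⁻ t in Set.Ioi 0, ν {a | t < 2 * h a} *
        ENNReal.ofReal (t ^ (p - 1 - 1))) := by gcongr
    _ = ENNReal.ofReal p * 2 * (ENNReal.ofReal (p - 1))⁻¹ * (ENNReal.ofReal (p - 1) *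
        ∫⁻ t in Set.Ioi 0, ν {a | t < 2 * h a} * ENNReal.ofReal (t ^ (p - 1 - 1))) := by
      rw [mul_assoc _ (ENNReal.ofReal (p - 1))⁻¹, ← mul_assoc (ENNReal.ofReal (p - 1))⁻¹,
        ENNReal.inv_mul_cancel (by simpa using hp1) (by simp)]
      ring
    _ = _ := by rw [← e1, e4]; ring

end Birkhoff

end VonMises

namespace VonMises

section Abstract

variable {X : Type} [MeasurableSpace X] {μ : Measure X}

lemma opNorm_le_of_tp {d : ℕ} {p : Fin d → ℝ≥0∞} [∀ i, Fact (1 ≤ p i)]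
    {E : Type} [NormedAddCommGroup E] [NormedSpace ℝ E] [CompleteSpace E]
    {tp : ContinuousMultilinearMap ℝ (fun i : Fin d => Lp ℝ (p i) μ) E}
    (hE : IsPTP μ p E tp) {F : Type} [NormedAddCommGroup F] [NormedSpace ℝ F] [CompleteSpace F]
    (B : E →L[ℝ] F) {C : ℝ} (hC : 0 ≤ C) (h : ∀ f, ‖B (tp f)‖ ≤ C * ∏ i, ‖f i‖) : ‖B‖ ≤ C := by
  obtain ⟨L, hL, hn⟩ := hE.lift F (B.compContinuousMultilinearMap tp)
  have hLB : L = B := by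
    refine ContinuousLinearMap.ext_on hE.denseSpan ?_
    rintro _ ⟨f, rfl⟩
    exact hL f
  rw [← hLB, hn]
  exact ContinuousMultilinearMap.opNorm_le_bound hC h

lemma banach_principle [IsProbabilityMeasure μ] {E : Type} [NormedAddCommGroup E] [NormedSpace ℝ E]
    {r : ℝ≥0∞} [hr1 : Fact (1 ≤ r)] (hr : r ≠ ∞) (A : ℕ → E →L[ℝ] Lp ℝ r μ) (I : E →L[ℝ] ℝ) (K : NNReal)
    (hmax : ∀ f, ∫⁻ x, (⨆ n, ‖(A n f : X → ℝ) x‖ₑ) ^ r.toReal ∂μ ≤ (K * ‖f‖ₑ) ^ r.toReal)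
    (S : Submodule ℝ E) (hS : Dense (S : Set E))
    (h : ∀ g ∈ S, ∀ᵐ x ∂μ, Tendsto (fun n => (A n g : X → ℝ) x) atTop (𝓝 (I g))) (f : E) :
    (∀ᵐ x ∂μ, Tendsto (fun n => (A n f : X → ℝ) x) atTop (𝓝 (I f))) ∧
    Tendsto (fun n => eLpNorm (fun x => (A n f : X → ℝ) x - I f) r μ) atTop (𝓝 0) := by
  have hr0 : r ≠ 0 := (zero_lt_one.trans_le hr1.out).ne'
  have hrr : 1 ≤ r.toReal := by
    have := ENNReal.toReal_mono hr hr1.out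
    simpa using this
  have hrr0 : 0 < r.toReal := by linarith
  set mm : E → X → ℝ≥0∞ := fun f x => ⨆ n, ‖(A n f : X → ℝ) x‖ₑ with hmm
  have mm_meas : ∀ f, Measurable (mm f) := fun f =>
    Measurable.iSup fun n => (Lp.stronglyMeasurable (A n f)).measurable.enorm
  have mm1 : ∀ f, ∫⁻ x, mm f x ∂μ ≤ K * ‖f‖ₑ := by
    intro f
    have h1 := eLpNorm_le_eLpNorm_of_exponent_le (μ := μ) hr1.out
      (mm_meas f).aestronglyMeasurable
    rw [eLpNorm_one_eq_lintegral_enorm, eLpNorm_eq_lintegral_rpow_enorm_toReal hr0 hr] at h1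
    simp only [enorm_eq_self] at h1
    refine h1.trans ?_
    refine (ENNReal.rpow_le_rpow (hmax f) (by positivity)).trans (le_of_eq ?_)
    rw [← ENNReal.rpow_mul, mul_one_div_cancel hrr0.ne', ENNReal.rpow_one]
  have conv : ∀ᵐ x ∂μ, Tendsto (fun n => (A n f : X → ℝ) x) atTop (𝓝 (I f)) := by
    have hex : ∀ j : ℕ, ∃ g ∈ S, ‖f - g‖ < (1 / 2) ^ j := fun j => by
      obtain ⟨g, hg, hg'⟩ := hS.exists_dist_lt f (ε := (1 / 2) ^ j) (by positivity)
      exact ⟨g, hg, by rwa [dist_eq_norm] at hg'⟩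
    choose g hgS hg using hex
    have hsum : ∑' j, ∫⁻ x, mm (f - g j) x ∂μ ≠ ∞ := by
      have : ∑' j, ∫⁻ x, mm (f - g j) x ∂μ ≤ ∑' j : ℕ, (K : ℝ≥0∞) * (2⁻¹) ^ j := by
        refine ENNReal.tsum_le_tsum fun j => (mm1 _).trans ?_
        gcongr
        rw [← ofReal_norm]
        refine (ENNReal.ofReal_le_ofReal (hg j).le).trans (le_of_eq ?_)
        rw [ENNReal.ofReal_pow (by norm_num), one_div, ENNReal.ofReal_inv_of_pos two_pos]
        simp
      refine ne_top_of_le_ne_top ?_ this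
      rw [ENNReal.tsum_mul_left, ENNReal.tsum_geometric]
      simp [ENNReal.mul_eq_top]
    rw [← lintegral_tsum fun j => (mm_meas _).aemeasurable] at hsum
    have hfin := ae_lt_top' (AEMeasurable.tsum fun j => (mm_meas _).aemeasurable) hsum
    have hsub : ∀ᵐ x ∂μ, ∀ j n, (A n (f - g j) : X → ℝ) x = (A n f : X → ℝ) x - (A n (g j) : X → ℝ) x := by
      refine ae_all_iff.2 fun j => ae_all_iff.2 fun n => ?_
      rw [map_sub]
      exact Lp.coeFn_sub _ _
    have hI : Tendsto (fun j => ‖I (f - g j)‖ₑ) atTop (𝓝 0) := by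
      have h1 : Tendsto (fun j => f - g j) atTop (𝓝 0) := by
        rw [tendsto_zero_iff_norm_tendsto_zero]
        exact squeeze_zero (fun _ => norm_nonneg _) (fun j => (hg j).le)
          (tendsto_pow_atTop_nhds_zero_of_lt_one (by norm_num) (by norm_num))
      have h2 := ((I.continuous.tendsto 0).comp h1).enorm
      simpa using h2
    filter_upwards [hfin, hsub, ae_all_iff.2 fun j => h (g j) (hgS j)] with x hx1 hx2 hx3
    have hG : Tendsto (fun j => mm (f - g j) x + ‖I (f - g j)‖ₑ) atTop (𝓝 0) := by
      simpa using (ENNReal.tendsto_atTop_zero_of_tsum_ne_top hx1.ne).add hI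
    rw [EMetric.tendsto_nhds]
    intro ε hε
    obtain ⟨j, hj⟩ := (hG.eventually_lt_const (ENNReal.half_pos hε.ne')).exists
    have h3 := (EMetric.tendsto_nhds.1 (hx3 j)) (ε / 2) (ENNReal.half_pos hε.ne')
    filter_upwards [h3] with n hn
    have e1 : (A n f : X → ℝ) x - I f = (A n (f - g j) : X → ℝ) x +
        ((A n (g j) : X → ℝ) x - I (g j)) + (-(I (f - g j))) := by
      rw [hx2, map_sub]; ring
    rw [edist_eq_enorm_sub, e1]
    rw [edist_eq_enorm_sub] at hn
    have h5 : ‖(A n (f - g j) : X → ℝ) x‖ₑ ≤ mm (f - g j) x :=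
      le_iSup (fun n => ‖(A n (f - g j) : X → ℝ) x‖ₑ) n
    calc _ ≤ ‖(A n (f - g j) : X → ℝ) x‖ₑ + ‖(A n (g j) : X → ℝ) x - I (g j)‖ₑ
          + ‖-(I (f - g j))‖ₑ := (enorm_add_le _ _).trans (by gcongr; exact enorm_add_le _ _)
      _ ≤ (mm (f - g j) x + ‖I (f - g j)‖ₑ) + ‖(A n (g j) : X → ℝ) x - I (g j)‖ₑ := by
        rw [enorm_neg, add_right_comm]; gcongr
      _ < ε / 2 + ε / 2 := ENNReal.add_lt_add hj hn
      _ = ε := ENNReal.add_halves ε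
  refine ⟨conv, ?_⟩
  have hbound : ∫⁻ x, (mm f x + ‖I f‖ₑ) ^ r.toReal ∂μ ≠ ∞ := by
    have h1 : ∫⁻ x, (mm f x + ‖I f‖ₑ) ^ r.toReal ∂μ ≤
        ∫⁻ x, 2 ^ (r.toReal - 1) * (mm f x ^ r.toReal + ‖I f‖ₑ ^ r.toReal) ∂μ :=
      lintegral_mono fun x => ENNReal.rpow_add_le_mul_rpow_add_rpow _ _ hrr
    refine ne_top_of_le_ne_top ?_ h1
    rw [lintegral_const_mul' _ _ (by simp), lintegral_add_right _ measurable_const]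
    refine ENNReal.mul_ne_top (by simp) (ENNReal.add_ne_top.2 ⟨?_, ?_⟩)
    · exact ne_top_of_le_ne_top (ENNReal.rpow_ne_top_of_nonneg hrr0.le
        (ENNReal.mul_ne_top (by simp) (by simp))) (hmax f)
    · simp [hrr0.le]
  have hl : Tendsto (fun n => ∫⁻ x, ‖(A n f : X → ℝ) x - I f‖ₑ ^ r.toReal ∂μ) atTop
      (𝓝 (∫⁻ x, 0 ∂μ)) := by
    refine tendsto_lintegral_of_dominated_convergence _ ?_ ?_ hbound ?_
    · intro n
      exact (((Lp.stronglyMeasurable (A n f)).measurable.sub_const _).enorm).pow_const _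
    · intro n
      refine ae_of_all _ fun x => ?_
      have h5 : ‖(A n f : X → ℝ) x‖ₑ ≤ mm f x := le_iSup (fun n => ‖(A n f : X → ℝ) x‖ₑ) n
      simp only
      gcongr
      exact (enorm_sub_le).trans (by gcongr)
    · filter_upwards [conv] with x hx
      have h1 := (hx.sub_const (I f)).enorm
      have h2 := ((ENNReal.continuous_rpow_const (y := r.toReal)).tendsto _).comp h1
      simpa [hrr0, Function.comp_def] using h2
  have h2 := ((ENNReal.continuous_rpow_const (y := 1 / r.toReal)).tendsto _).comp hl
  simp only [lintegral_zero] at h2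
  rw [ENNReal.zero_rpow_of_pos (by positivity)] at h2
  refine h2.congr fun n => ?_
  rw [eLpNorm_eq_lintegral_rpow_enorm_toReal hr0 hr]
  rfl

lemma prod_max [IsProbabilityMeasure μ] {T : X → X} (hT : MeasurePreserving T μ μ) {d : ℕ}
    (hd : 0 < d) {p r : ℝ} (hp : 1 < p) (hpr : p = r * d) (f : Fin d → X → ℝ)
    (hfm : ∀ i, Measurable (f i)) (hfi : ∀ i, Integrable (f i) μ) (N : ℕ) :
    (∫⁻ x, (∏ i, ‖avgVec T (fun y => |f i y|) N x‖ₑ) ^ r ∂μ) ^ (1 / r) ≤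
      ∏ i, (ENNReal.ofReal (p / (p - 1) * 2 ^ p) ^ (1 / p) *
        (∫⁻ x, ‖f i x‖ₑ ^ p ∂μ) ^ (1 / p)) := by
  have hd' : (0 : ℝ) < d := by exact_mod_cast hd
  have hp0 : 0 < p := by linarith
  have hr0 : 0 < r := by
    by_contra! hcon
    nlinarith
  have key : ∀ i, ∫⁻ x, ‖avgVec T (fun y => |f i y|) N x‖ₑ ^ p ∂μ ≤
      ENNReal.ofReal (p / (p - 1) * 2 ^ p) * ∫⁻ x, ‖f i x‖ₑ ^ p ∂μ := by
    intro i
    have := strong_max hT (hfm i).abs (fun x => abs_nonneg _) (hfi i).abs N hp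
    simpa only [← ENNReal.ofReal_rpow_of_nonneg (norm_nonneg _) hp0.le,
      ← ENNReal.ofReal_rpow_of_nonneg (abs_nonneg _) hp0.le, ofReal_norm,
      ← Real.enorm_eq_ofReal_abs] using this
  have h1 : ∫⁻ x, (∏ i, ‖avgVec T (fun y => |f i y|) N x‖ₑ) ^ r ∂μ ≤
      ∏ i, (∫⁻ x, ‖avgVec T (fun y => |f i y|) N x‖ₑ ^ p ∂μ) ^ ((1 : ℝ) / d) := by
    have h2 := ENNReal.lintegral_prod_norm_pow_le (μ := μ) (Finset.univ : Finset (Fin d))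
      (f := fun i x => ‖avgVec T (fun y => |f i y|) N x‖ₑ ^ p) (p := fun _ => (1 : ℝ) / d)
      (fun i _ => ((avgVec_measurable hT.measurable (hfm i).abs N).enorm.pow_const _).aemeasurable)
      (by simp; field_simp) (fun i _ => by positivity)
    refine le_trans (le_of_eq ?_) h2
    congr 1 with x
    rw [← ENNReal.prod_rpow_of_nonneg hr0.le]
    refine Finset.prod_congr rfl fun i _ => ?_
    rw [← ENNReal.rpow_mul]; congr 1; rw [hpr]; field_simp
  calc _ ≤ (∏ i, (∫⁻ x, ‖avgVec T (fun y => |f i y|) N x‖ₑ ^ p ∂μ) ^ ((1 : ℝ) / d)) ^ (1 / r) := by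
        gcongr
    _ = ∏ i, (∫⁻ x, ‖avgVec T (fun y => |f i y|) N x‖ₑ ^ p ∂μ) ^ (1 / p) := by
      rw [← ENNReal.prod_rpow_of_nonneg (by positivity)]
      refine Finset.prod_congr rfl fun i _ => ?_
      rw [← ENNReal.rpow_mul]; congr 1; rw [hpr]; field_simp
    _ ≤ ∏ i, (ENNReal.ofReal (p / (p - 1) * 2 ^ p) * ∫⁻ x, ‖f i x‖ₑ ^ p ∂μ) ^ (1 / p) := by
      gcongr with i
      exact key i
    _ = _ := by
      refine Finset.prod_congr rfl fun i _ => ?_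
      rw [ENNReal.mul_rpow_of_nonneg _ _ (by positivity)]

end Abstract

end VonMises

namespace VonMises

section Main

set_option linter.unusedSectionVars false

variable {X : Type} [MeasurableSpace X] {μ : Measure X}

/-- The normalized von Mises statistic as an operator. -/
def avgOp {d : ℕ} {r : ℝ≥0∞} [Fact (1 ≤ r)]
    {E : Type} [NormedAddCommGroup E] [NormedSpace ℝ E]
    (D : E →L[ℝ] Lp ℝ r μ) (W : (Fin d → ℕ) → E →L[ℝ] E) (n : ℕ) : E →L[ℝ] Lp ℝ r μ :=
  ((n : ℝ) ^ d)⁻¹ • ∑ k ∈ Fintype.piFinset (fun _ : Fin d => Finset.range n), D.comp (W k)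

lemma Lp_coeFn_sum {r : ℝ≥0∞} {F : Type} [NormedAddCommGroup F] {ι : Type} (s : Finset ι)
    (g : ι → Lp F r μ) :
    ((∑ i ∈ s, g i : Lp F r μ) : X → F) =ᵐ[μ] fun x => ∑ i ∈ s, (g i : X → F) x := by
  classical
  induction s using Finset.induction_on with
  | empty => simp only [Finset.sum_empty]; exact Lp.coeFn_zero F r μ
  | insert a s ha ih =>
    rw [Finset.sum_insert ha]
    filter_upwards [Lp.coeFn_add (g a) (∑ i ∈ s, g i), ih] with x h1 h2
    rw [h1, Pi.add_apply, h2, Finset.sum_insert ha]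

lemma avgOp_coe {d : ℕ} {r : ℝ≥0∞} [Fact (1 ≤ r)]
    {E : Type} [NormedAddCommGroup E] [NormedSpace ℝ E]
    (D : E →L[ℝ] Lp ℝ r μ) (W : (Fin d → ℕ) → E →L[ℝ] E) (n : ℕ) (f : E) :
    (avgOp D W n f : X → ℝ) =ᵐ[μ] fun x => ((n : ℝ) ^ d)⁻¹ *
      ∑ k ∈ Fintype.piFinset (fun _ : Fin d => Finset.range n), (D (W k f) : X → ℝ) x := by
  have e : avgOp D W n f = ((n : ℝ) ^ d)⁻¹ •
      ∑ k ∈ Fintype.piFinset (fun _ : Fin d => Finset.range n), D (W k f) := by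
    simp [avgOp]
  rw [e]
  filter_upwards [Lp.coeFn_smul (((n : ℝ) ^ d)⁻¹)
    (∑ k ∈ Fintype.piFinset (fun _ : Fin d => Finset.range n), D (W k f)),
    Lp_coeFn_sum (Fintype.piFinset (fun _ : Fin d => Finset.range n)) (fun k => D (W k f))]
    with x h1 h2
  rw [h1, Pi.smul_apply, h2, smul_eq_mul]

lemma avgOp_tp {d : ℕ} {p r : ℝ≥0∞} [Fact (1 ≤ p)] [Fact (1 ≤ r)]
    {T : X → X} (hT : MeasurePreserving T μ μ)
    {E : Type} [NormedAddCommGroup E] [NormedSpace ℝ E] [CompleteSpace E]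
    {tp : ContinuousMultilinearMap ℝ (fun _ : Fin d => Lp ℝ p μ) E}
    {D : E →L[ℝ] Lp ℝ r μ} (hD : IsDiag μ (fun _ : Fin d => p) r tp D)
    {W : (Fin d → ℕ) → E →L[ℝ] E}
    (hW : ∀ k, IsTKoop μ (fun _ : Fin d => p) tp (fun _ => T) k (W k)) (n : ℕ)
    (f : Fin d → Lp ℝ p μ) :
    (avgOp D W n (tp f) : X → ℝ) =ᵐ[μ]
      fun x => ∏ i, ((n : ℝ)⁻¹ * birkhoffSum T (f i : X → ℝ) n x) := by
  have hk : ∀ k : Fin d → ℕ, (D (W k (tp f)) : X → ℝ) =ᵐ[μ]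
      fun x => ∏ i, (f i : X → ℝ) (T^[k i] x) := by
    intro k
    have hg : ∀ i, (Lp.compMeasurePreserving (T^[k i]) (hT.iterate (k i)) (f i) : X → ℝ)
        =ᵐ[μ] fun x => (f i : X → ℝ) (T^[k i] x) :=
      fun i => Lp.coeFn_compMeasurePreserving (f i) (hT.iterate (k i))
    rw [hW k f (fun i => Lp.compMeasurePreserving (T^[k i]) (hT.iterate (k i)) (f i)) hg]
    filter_upwards [hD.2 (fun i => Lp.compMeasurePreserving (T^[k i]) (hT.iterate (k i)) (f i)),
      ae_all_iff.2 hg] with x h1 h2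
    rw [h1]
    exact Finset.prod_congr rfl fun i _ => h2 i
  filter_upwards [avgOp_coe D W n (tp f), ae_all_iff.2 hk] with x h1 h2
  rw [h1, Finset.prod_mul_distrib, Finset.prod_const, Finset.card_univ, Fintype.card_fin, inv_pow]
  congr 1
  simp only [birkhoffSum]
  rw [Finset.prod_univ_sum]
  exact Finset.sum_congr rfl fun k _ => h2 k

/-- The vector of the first `N` averages as an operator. -/
def vecOp {r : ℝ≥0∞} [Fact (1 ≤ r)]
    {E : Type} [NormedAddCommGroup E] [NormedSpace ℝ E]
    (A : ℕ → E →L[ℝ] Lp ℝ r μ) (N : ℕ) : E →L[ℝ] Lp (Fin N → ℝ) r μ :=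
  ∑ n : Fin N, ((ContinuousLinearMap.single ℝ (fun _ : Fin N => ℝ) n).compLpL r μ).comp (A n)

lemma vecOp_coe {r : ℝ≥0∞} [Fact (1 ≤ r)]
    {E : Type} [NormedAddCommGroup E] [NormedSpace ℝ E]
    (A : ℕ → E →L[ℝ] Lp ℝ r μ) (N : ℕ) (f : E) :
    (vecOp A N f : X → Fin N → ℝ) =ᵐ[μ] fun x n => (A n f : X → ℝ) x := by
  have e : vecOp A N f = ∑ n : Fin N,
      (ContinuousLinearMap.single ℝ (fun _ : Fin N => ℝ) n).compLpL r μ (A n f) := by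
    simp [vecOp]
  rw [e]
  filter_upwards [Lp_coeFn_sum Finset.univ (fun n : Fin N =>
      (ContinuousLinearMap.single ℝ (fun _ : Fin N => ℝ) n).compLpL r μ (A n f)),
    ae_all_iff.2 fun n : Fin N => ContinuousLinearMap.coeFn_compLpL
      (ContinuousLinearMap.single ℝ (fun _ : Fin N => ℝ) n) (A n f)] with x h1 h2
  rw [h1]
  simp only [h2]
  ext m
  simp [Finset.sum_apply, Pi.single_apply]

lemma abs_birkhoffSum_le (T : X → X) (f : X → ℝ) (n : ℕ) (x : X) :
    |birkhoffSum T f n x| ≤ birkhoffSum T (fun y => |f y|) n x :=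
  Finset.abs_sum_le_sum_abs _ _

lemma vecOp_bound [IsProbabilityMeasure μ]
    {d : ℕ} (hd : 2 ≤ d) {p r : ℝ≥0∞} [Fact (1 ≤ p)] [Fact (1 ≤ r)]
    (hp : (d : ℝ≥0∞) ≤ p) (hp' : p ≠ ∞) (hr : r = p / d)
    {T : X → X} (hT : MeasurePreserving T μ μ)
    {E : Type} [NormedAddCommGroup E] [NormedSpace ℝ E] [CompleteSpace E]
    {tp : ContinuousMultilinearMap ℝ (fun _ : Fin d => Lp ℝ p μ) E}
    (hE : IsPTP μ (fun _ : Fin d => p) E tp)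
    {D : E →L[ℝ] Lp ℝ r μ} (hD : IsDiag μ (fun _ : Fin d => p) r tp D)
    {W : (Fin d → ℕ) → E →L[ℝ] E}
    (hW : ∀ k, IsTKoop μ (fun _ : Fin d => p) tp (fun _ => T) k (W k)) :
    ∃ C : NNReal, ∀ N, ‖vecOp (avgOp D W) N‖ ≤ C := by
  have hd0 : (d : ℝ≥0∞) ≠ 0 := by simp; omega
  have hp1 : 1 < p.toReal := by
    have h1 := ENNReal.toReal_mono hp' hp
    have h2 : (2 : ℝ) ≤ d := by exact_mod_cast hd
    simp only [ENNReal.toReal_natCast] at h1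
    linarith
  have hr' : r ≠ ∞ := by rw [hr]; exact ENNReal.div_ne_top hp' hd0
  have hr0 : r ≠ 0 := (zero_lt_one.trans_le (Fact.out : 1 ≤ r)).ne'
  have hp0 : p ≠ 0 := (zero_lt_one.trans_le (Fact.out : 1 ≤ p)).ne'
  have hpr : p.toReal = r.toReal * d := by
    rw [hr, ENNReal.toReal_div, ENNReal.toReal_natCast]
    have : (d : ℝ) ≠ 0 := by positivity
    field_simp
  set c : ℝ≥0∞ := ENNReal.ofReal (p.toReal / (p.toReal - 1) * 2 ^ p.toReal) ^ (1 / p.toReal)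
    with hc
  have hcf : c ≠ ∞ := ENNReal.rpow_ne_top_of_nonneg (by positivity) ENNReal.ofReal_ne_top
  refine ⟨c.toNNReal ^ d, fun N => ?_⟩
  refine opNorm_le_of_tp hE _ (NNReal.coe_nonneg _) fun f => ?_
  have key : ‖vecOp (avgOp D W) N (tp f)‖ₑ ≤ c ^ d * ∏ i, ‖f i‖ₑ := by
    rw [Lp.enorm_def, eLpNorm_eq_lintegral_rpow_enorm_toReal hr0 hr']
    have h1 := prod_max hT (by omega : 0 < d) hp1 hpr (fun i => (f i : X → ℝ))
      (fun i => (Lp.stronglyMeasurable (f i)).measurable)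
      (fun i => (Lp.memLp (f i)).integrable Fact.out) N
    refine le_trans ?_ (h1.trans (le_of_eq ?_))
    · refine ENNReal.rpow_le_rpow (lintegral_mono_ae ?_) (by positivity)
      filter_upwards [vecOp_coe (avgOp D W) N (tp f),
        ae_all_iff.2 fun n => avgOp_tp hT hD hW n f] with x h2 h3
      rw [h2]
      refine ENNReal.rpow_le_rpow ?_ (by positivity)
      simp only [h3, ← ofReal_norm]
      rw [← ENNReal.ofReal_prod_of_nonneg fun _ _ => norm_nonneg _]
      refine ENNReal.ofReal_le_ofReal ?_
      rw [pi_norm_le_iff_of_nonneg (Finset.prod_nonneg fun _ _ => norm_nonneg _)]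
      intro n
      rw [norm_prod]
      refine Finset.prod_le_prod (fun _ _ => norm_nonneg _) fun i _ => ?_
      refine le_trans ?_ (norm_le_pi_norm (avgVec T (fun y => |(f i : X → ℝ) y|) N x) n)
      rw [avgVec, norm_mul, norm_mul]
      gcongr
      exact (abs_birkhoffSum_le T _ _ _).trans (le_abs_self _)
    · rw [Finset.prod_mul_distrib, Finset.prod_const, Finset.card_univ, Fintype.card_fin]
      congr 1
      refine Finset.prod_congr rfl fun i _ => ?_
      rw [Lp.enorm_def, eLpNorm_eq_lintegral_rpow_enorm_toReal hp0 hp']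
  have h4 := ENNReal.toReal_mono (by
    refine ENNReal.mul_ne_top (ENNReal.pow_ne_top hcf) (ENNReal.prod_ne_top fun i _ => by simp)) key
  simpa [ENNReal.coe_toNNReal_eq_toReal, ENNReal.toReal_mul, ENNReal.toReal_prod, ENNReal.toReal_pow] using h4

lemma max_bound {r : ℝ≥0∞} [hr1 : Fact (1 ≤ r)] (hr : r ≠ ∞)
    {E : Type} [NormedAddCommGroup E] [NormedSpace ℝ E]
    (A : ℕ → E →L[ℝ] Lp ℝ r μ) (C : NNReal) (hC : ∀ N, ‖vecOp A N‖ ≤ C) (f : E) :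
    ∫⁻ x, (⨆ n, ‖(A n f : X → ℝ) x‖ₑ) ^ r.toReal ∂μ ≤ (C * ‖f‖ₑ) ^ r.toReal := by
  have hr0 : r ≠ 0 := (zero_lt_one.trans_le hr1.out).ne'
  have hrr0 : 0 < r.toReal := ENNReal.toReal_pos hr0 hr
  set v : ∀ N, X → Fin N → ℝ := fun N x n => (A n f : X → ℝ) x with hv
  have hvm : ∀ N, Measurable (v N) := fun N => measurable_pi_lambda _ fun n =>
    (Lp.stronglyMeasurable (A n f)).measurable
  have hle : ∀ x, (⨆ n, ‖(A n f : X → ℝ) x‖ₑ) ≤ ⨆ N, ‖v N x‖ₑ := by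
    intro x
    refine iSup_le fun n => le_iSup_of_le (n + 1) ?_
    rw [enorm_le_iff_norm_le]
    exact norm_le_pi_norm (v (n + 1) x) ⟨n, Nat.lt_succ_self n⟩
  have hmono : ∀ x, Monotone fun N => ‖v N x‖ₑ := by
    intro x N M hNM
    simp only
    rw [enorm_le_iff_norm_le, pi_norm_le_iff_of_nonneg (norm_nonneg _)]
    intro n
    exact norm_le_pi_norm (v M x) ⟨n, n.2.trans_le hNM⟩
  calc ∫⁻ x, (⨆ n, ‖(A n f : X → ℝ) x‖ₑ) ^ r.toReal ∂μ
      ≤ ∫⁻ x, ⨆ N, ‖v N x‖ₑ ^ r.toReal ∂μ := by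
        refine lintegral_mono fun x => ?_
        refine (ENNReal.rpow_le_rpow (hle x) hrr0.le).trans (le_of_eq ?_)
        exact (ENNReal.orderIsoRpow r.toReal hrr0).map_iSup _
    _ = ⨆ N, ∫⁻ x, ‖v N x‖ₑ ^ r.toReal ∂μ := by
        refine lintegral_iSup (fun N => (hvm N).enorm.pow_const _) fun N M hNM x => ?_
        exact ENNReal.rpow_le_rpow (hmono x hNM) hrr0.le
    _ ≤ _ := by
        refine iSup_le fun N => ?_
        have h1 : ‖vecOp A N f‖ₑ ≤ C * ‖f‖ₑ := by
          have h2 : ‖vecOp A N f‖ ≤ C * ‖f‖ := (vecOp A N).le_of_opNorm_le (hC N) f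
          rw [← ofReal_norm, ← ofReal_norm]
          refine (ENNReal.ofReal_le_ofReal h2).trans (le_of_eq ?_)
          rw [ENNReal.ofReal_mul (NNReal.coe_nonneg _), ENNReal.ofReal_coe_nnreal]
        rw [Lp.enorm_def, eLpNorm_congr_ae (vecOp_coe A N f),
          eLpNorm_eq_lintegral_rpow_enorm_toReal hr0 hr] at h1
        have h3 := ENNReal.rpow_le_rpow h1 hrr0.le
        rwa [← ENNReal.rpow_mul, one_div_mul_cancel hrr0.ne', ENNReal.rpow_one] at h3

/-- Integration as a continuous linear functional on `L_p` of a probability space. -/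
lemma exists_integral_clm {Y : Type} [MeasurableSpace Y] (ν : Measure Y) [IsProbabilityMeasure ν]
    (p : ℝ≥0∞) [hp : Fact (1 ≤ p)] :
    ∃ I : Lp ℝ p ν →L[ℝ] ℝ, ∀ g : Lp ℝ p ν, I g = ∫ y, (g : Y → ℝ) y ∂ν := by
  have hi : ∀ g : Lp ℝ p ν, Integrable (g : Y → ℝ) ν := fun g => (Lp.memLp g).integrable hp.out
  refine ⟨LinearMap.mkContinuous ⟨⟨fun g => ∫ y, (g : Y → ℝ) y ∂ν, fun g h => ?_⟩, fun c g => ?_⟩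
    1 fun g => ?_, fun g => rfl⟩
  · rw [integral_congr_ae (Lp.coeFn_add g h)]
    exact integral_add (hi g) (hi h)
  · simp only [RingHom.id_apply, smul_eq_mul]
    rw [integral_congr_ae (Lp.coeFn_smul c g)]
    exact integral_const_mul c _
  · change ‖∫ y, (g : Y → ℝ) y ∂ν‖ ≤ 1 * ‖g‖
    rw [one_mul, ← enorm_le_iff_norm_le, Lp.enorm_def]
    refine (enorm_integral_le_lintegral_enorm _).trans ?_
    rw [← eLpNorm_one_eq_lintegral_enorm]
    exact eLpNorm_le_eLpNorm_of_exponent_le hp.out (Lp.aestronglyMeasurable g)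

end Main

end VonMises

namespace VonMises

/-- Theorem 1, SLLN for von Mises statistics: for an ergodic `T`,
`p ≥ d` and `f ∈ L_{p,π}(μ^d)`, the normalized `V`-statistics
`n^{-d} Σ_{0≤k_1,…,k_d≤n-1} D_d V^{(k_1,…,k_d)} f` converge `μ`-a.s. and in `L_r(μ)`,
`r = p/d`, to the constant `∫_{X^d} J_d f dμ^d`. -/
theorem statement7
    {X : Type} [MeasurableSpace X] [StandardBorelSpace X]
    (μ : Measure X) [IsProbabilityMeasure μ]
    (d : ℕ) (hd : 2 ≤ d) (p r : ℝ≥0∞) [Fact (1 ≤ p)] [Fact (1 ≤ r)]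
    (hp : (d : ℝ≥0∞) ≤ p) (hp' : p ≠ ∞) (hr : r = p / d)
    (T : X → X) (hT : MeasurePreserving T μ μ) (herg : Ergodic T μ)
    (E : Type) [NormedAddCommGroup E] [NormedSpace ℝ E] [CompleteSpace E]
    (tp : ContinuousMultilinearMap ℝ (fun _ : Fin d => Lp ℝ p μ) E)
    (hE : IsPTP μ (fun _ : Fin d => p) E tp)
    (J : E →L[ℝ] Lp ℝ p (pm μ d)) (hJ : IsEmbed μ (fun _ : Fin d => p) p tp J)
    (D : E →L[ℝ] Lp ℝ r μ) (hD : IsDiag μ (fun _ : Fin d => p) r tp D)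
    (W : (Fin d → ℕ) → E →L[ℝ] E)
    (hW : ∀ k, IsTKoop μ (fun _ : Fin d => p) tp (fun _ => T) k (W k))
    (f : E) :
    (∀ᵐ x ∂μ, Tendsto (fun n : ℕ =>
        ((n : ℝ) ^ d)⁻¹ *
          ∑ k ∈ Fintype.piFinset (fun _ : Fin d => Finset.range n), (D (W k f) : X → ℝ) x)
      atTop (𝓝 (∫ y, (J f : (Fin d → X) → ℝ) y ∂ pm μ d))) ∧
    Tendsto (fun n : ℕ => eLpNorm (fun x =>
        ((n : ℝ) ^ d)⁻¹ *
          (∑ k ∈ Fintype.piFinset (fun _ : Fin d => Finset.range n), (D (W k f) : X → ℝ) x) -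
          ∫ y, (J f : (Fin d → X) → ℝ) y ∂ pm μ d) r μ)
      atTop (𝓝 0) := by
  have hd0 : (d : ℝ≥0∞) ≠ 0 := by simp; omega
  have hr' : r ≠ ∞ := by rw [hr]; exact ENNReal.div_ne_top hp' hd0
  obtain ⟨C, hC⟩ := vecOp_bound hd hp hp' hr hT hE hD hW
  obtain ⟨I₀, hI₀⟩ := exists_integral_clm (pm μ d) p
  have hmain := banach_principle hr' (avgOp D W) (I₀.comp J) C
    (max_bound hr' (avgOp D W) C hC) _ hE.denseSpan (fun g hg => by
      induction hg using Submodule.span_induction with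
      | mem g hg =>
        obtain ⟨u, rfl⟩ := hg
        have e : I₀.comp J (tp u) = ∏ i, ∫ x, (u i : X → ℝ) x ∂μ := by
          rw [ContinuousLinearMap.comp_apply, hI₀, integral_congr_ae (hJ u)]
          exact integral_fintype_prod_eq_prod (fun i x => (u i : X → ℝ) x)
        simp only [e]
        filter_upwards [ae_all_iff.2 fun n => avgOp_tp hT hD hW n u,
          ae_all_iff.2 fun i => birkhoff_ergodic herg (Lp.stronglyMeasurable (u i)).measurable
            ((Lp.memLp (u i)).integrable Fact.out)] with x h1 h2
        simp only [h1]
        exact tendsto_finsetProd _ fun i _ => h2 i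
      | zero =>
        have : ∀ᵐ x ∂μ, ∀ n, (avgOp D W n (0 : E) : X → ℝ) x = 0 := ae_all_iff.2 fun n => by
          rw [map_zero]; exact Lp.coeFn_zero ℝ r μ
        filter_upwards [this] with x hx
        rw [map_zero]
        exact tendsto_const_nhds.congr fun n => (hx n).symm
      | add g h _ _ ihg ihh =>
        have : ∀ᵐ x ∂μ, ∀ n, (avgOp D W n (g + h) : X → ℝ) x =
            (avgOp D W n g : X → ℝ) x + (avgOp D W n h : X → ℝ) x := ae_all_iff.2 fun n => by
          rw [map_add]; exact Lp.coeFn_add _ _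
        filter_upwards [this, ihg, ihh] with x hx h1 h2
        rw [map_add]
        exact (h1.add h2).congr fun n => (hx n).symm
      | smul c g _ ihg =>
        have : ∀ᵐ x ∂μ, ∀ n, (avgOp D W n (c • g) : X → ℝ) x =
            c * (avgOp D W n g : X → ℝ) x := ae_all_iff.2 fun n => by
          rw [map_smul]; exact Lp.coeFn_smul _ _
        filter_upwards [this, ihg] with x hx h1
        rw [map_smul]
        exact (h1.const_mul c).congr fun n => (hx n).symm) f
  have hIf : I₀.comp J f = ∫ y, (J f : (Fin d → X) → ℝ) y ∂ pm μ d := hI₀ (J f)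
  rw [hIf] at hmain
  refine ⟨?_, ?_⟩
  · filter_upwards [hmain.1, ae_all_iff.2 fun n => avgOp_coe D W n f] with x h1 h2
    exact h1.congr h2
  · refine hmain.2.congr fun n => eLpNorm_congr_ae ?_
    filter_upwards [avgOp_coe D W n f] with x h1
    rw [h1]

end VonMises
end
end
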